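/- Let k be a field of characteristic 2, let m ≥ 1 be an integer, and let F be a field extension of k. Let a₁, …, a_m ∈ F and b₁, …, b_m ∈ Fˣ be such that the tensor product [a₁,b₁)_F ⊗_F … ⊗_F [a_m,b_m)_F is split. Then there exist an intermediate field L with k ⊆ L ⊆ F whose transcendence degree over k is at most 2^m + m, and elements a'₁, …, a'_m ∈ L and b'₁, …, b'_m ∈ L \ {0} such that [a'ᵢ,b'ᵢ)_F ≅ [aᵢ,bᵢ)_F as F-algebras for each 1 ≤ i ≤ m, and the tensor product [a'₁,b'₁)_L ⊗_L … ⊗_L [a'_m,b'_m)_L is split over L. -/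

import Mathlib

open FreeAlgebra in
inductive QuatRel (F : Type*) [Field F] (a b : F) :
    FreeAlgebra F (Fin 2) → FreeAlgebra F (Fin 2) → Prop
  | u_sq : QuatRel F a b (ι F 0 * ι F 0 - ι F 0) (algebraMap F _ a)
  | v_sq : QuatRel F a b (ι F 1 * ι F 1) (algebraMap F _ b)
  | vu : QuatRel F a b (ι F 1 * ι F 0) ((1 - ι F 0) * ι F 1)

/-- The quaternion algebra `[a,b)_F` over a field of characteristic `2`:
generated by `u, v` with `u² - u = a`, `v² = b`, `vu = (1-u)v`. -/
def QuatAlg (F : Type*) [Field F] (a b : F) : Type _ :=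
  RingQuot (QuatRel F a b)

instance (F : Type*) [Field F] (a b : F) : Ring (QuatAlg F a b) :=
  inferInstanceAs (Ring (RingQuot (QuatRel F a b)))

instance (F : Type*) [Field F] (a b : F) : Algebra F (QuatAlg F a b) :=
  inferInstanceAs (Algebra F (RingQuot (QuatRel F a b)))

open scoped TensorProduct

/-- The transcendence degree of `L` over `k`: the supremum of cardinalities of
algebraically independent subsets of `L`. -/
noncomputable def trdeg (k L : Type*) [CommRing k] [CommRing L] [Algebra k L] : Cardinal :=
  ⨆ s : { s : Set L // AlgebraicIndependent k ((↑) : s → L) }, Cardinal.mk s.1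

theorem map_prod_smul {F C V : Type*} [Field F] [CommRing C] [AddCommGroup V] [Module F V]
    [Module C V] {m : ℕ} {v : Fin m → C} {u : Fin m → V →ₗ[F] V}
    (huv : ∀ i j x, u i (v j • x) = v j • u i x + if i = j then v j • x else 0)
    (i : Fin m) (S : Finset (Fin m)) (x : V) :
    u i ((∏ j ∈ S, v j) • x) =
      (∏ j ∈ S, v j) • u i x + if i ∈ S then (∏ j ∈ S, v j) • x else 0 := by
  induction S using Finset.induction_on with
  | empty => simp
  | insert j S hj ih =>
    rw [Finset.prod_insert hj, mul_smul, huv, ih]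
    by_cases h : i = j
    · subst h; simp [hj, mul_smul]
    · by_cases hS : i ∈ S <;> simp [h, hS, mul_smul, smul_add]

section SquareRootAlgebra

variable {F C V : Type*} [Field F] [CommRing C] [Algebra F C]
  [AddCommGroup V] [Module F V] [Module C V] [IsScalarTower F C V] {m : ℕ}

theorem filter_induction (P : (Finset (Fin m) → F) → Prop)
    (h1 : ∀ x i, P x → P (fun S => if i ∈ S then x S else 0))
    (h2 : ∀ x i, P x → P (fun S => if i ∈ S then 0 else x S))
    (x : Finset (Fin m) → F) (hx : P x) (S₀ : Finset (Fin m)) : P (Pi.single S₀ (x S₀)) := by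
  classical
  have key : ∀ T : Finset (Fin m),
      P (fun S => if ∀ j ∈ T, (j ∈ S ↔ j ∈ S₀) then x S else 0) := by
    intro T
    induction T using Finset.induction_on with
    | empty => simpa using hx
    | insert i T _ ih =>
      by_cases hi : i ∈ S₀
      · convert h1 _ i ih using 2 with S
        by_cases hS : i ∈ S <;> simp [hi, hS]
      · convert h2 _ i ih using 2 with S
        by_cases hS : i ∈ S <;> simp [hi, hS]
  convert key Finset.univ using 1
  ext S
  by_cases hS : S = S₀
  · subst hS; simp
  · rw [Pi.single_eq_of_ne hS, if_neg]
    intro h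
    exact hS (Finset.ext fun j => h j (Finset.mem_univ j))

theorem prod_mul_prod_eq_symmDiff {v : Fin m → C} {b : Fin m → F}
    (hv : ∀ i, v i * v i = algebraMap F C (b i)) (S T : Finset (Fin m)) :
    (∏ i ∈ S, v i) * ∏ i ∈ T, v i =
      (∏ i ∈ S ∩ T, b i) • ∏ i ∈ symmDiff S T, v i := by
  have h : S ∪ T = symmDiff S T ∪ (S ∩ T) := by
    ext x; simp only [Finset.mem_union, Finset.mem_inter, Finset.mem_symmDiff]; tauto
  have hd : Disjoint (symmDiff S T) (S ∩ T) := by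
    rw [Finset.disjoint_left]
    intro x; simp only [Finset.mem_inter, Finset.mem_symmDiff]; tauto
  rw [← Finset.prod_union_inter, h, Finset.prod_union hd, mul_assoc, ← Finset.prod_mul_distrib,
    Algebra.smul_def, map_prod, mul_comm]
  simp [hv]

theorem span_prod_eq_top {v : Fin m → C} {b : Fin m → F}
    (hv : ∀ i, v i * v i = algebraMap F C (b i))
    (hgen : Algebra.adjoin F (Set.range v) = ⊤) :
    Submodule.span F (Set.range fun S : Finset (Fin m) => ∏ i ∈ S, v i) = ⊤ := by
  rw [eq_top_iff]
  intro c _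
  have hc : c ∈ Algebra.adjoin F (Set.range v) := hgen ▸ Algebra.mem_top
  induction hc using Algebra.adjoin_induction with
  | mem x hx =>
    obtain ⟨i, rfl⟩ := hx
    exact Submodule.subset_span ⟨{i}, by simp⟩
  | algebraMap r =>
    rw [Algebra.algebraMap_eq_smul_one]
    exact Submodule.smul_mem _ _ (Submodule.subset_span ⟨∅, by simp⟩)
  | add x y _ _ hx hy => exact add_mem (hx trivial) (hy trivial)
  | mul x y _ _ hx hy =>
    have hxy := Submodule.mul_mem_mul (hx trivial) (hy trivial)
    rw [Submodule.span_mul_span] at hxy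
    refine Submodule.span_le.2 ?_ hxy
    rintro _ ⟨_, ⟨S, rfl⟩, _, ⟨T, rfl⟩, rfl⟩
    simp only [prod_mul_prod_eq_symmDiff hv]
    exact Submodule.smul_mem _ _ (Submodule.subset_span ⟨_, rfl⟩)

theorem isUnit_prod_of_sq {v : Fin m → C} {b : Fin m → F} (hb : ∀ i, b i ≠ 0)
    (hv : ∀ i, v i * v i = algebraMap F C (b i)) (S : Finset (Fin m)) :
    IsUnit (∏ i ∈ S, v i) := by
  induction S using Finset.induction_on with
  | empty => simp
  | insert i S hi ih =>
    rw [Finset.prod_insert hi]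
    refine IsUnit.mul (isUnit_of_mul_isUnit_left (y := v i) ?_) ih
    rw [hv]
    exact (IsUnit.mk0 _ (hb i)).map _

theorem linearIndependent_prod [FaithfulSMul C V] [Nontrivial C]
    {v : Fin m → C} {b : Fin m → F} {u : Fin m → V →ₗ[F] V} (hb : ∀ i, b i ≠ 0)
    (hv : ∀ i, v i * v i = algebraMap F C (b i))
    (huv : ∀ i j x, u i (v j • x) = v j • u i x + if i = j then v j • x else 0) :
    LinearIndependent F fun S : Finset (Fin m) => ∏ i ∈ S, v i := by
  rw [Fintype.linearIndependent_iff]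
  intro x hx S₀
  have h1 : ∀ (x : Finset (Fin m) → F) (i : Fin m), ∑ S, x S • ∏ j ∈ S, v j = 0 →
      ∑ S, (if i ∈ S then x S else 0) • ∏ j ∈ S, v j = 0 := by
    intro x i hx
    refine FaithfulSMul.eq_of_smul_eq_smul (α := V) fun y => ?_
    have h0 : ∀ y : V, ∑ S, x S • (∏ j ∈ S, v j) • y = 0 := fun y => by
      simpa [Finset.sum_smul] using congrArg (· • y) hx
    have h : ∑ S, x S • ((∏ j ∈ S, v j) • u i y + if i ∈ S then (∏ j ∈ S, v j) • y else 0)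
        = 0 := by
      simpa only [map_sum, map_smul, map_prod_smul huv, map_zero] using congrArg (u i) (h0 y)
    simp only [smul_add, Finset.sum_add_distrib, h0, zero_add] at h
    rw [Finset.sum_smul, zero_smul, ← h]
    refine Finset.sum_congr rfl fun S _ => ?_
    by_cases hS : i ∈ S <;> simp [hS]
  have := filter_induction (fun x => ∑ S, x S • ∏ j ∈ S, v j = 0) h1 (fun x i hx => by
    have h := h1 x i hx
    rw [← sub_eq_zero.2 (hx.trans h.symm), ← Finset.sum_sub_distrib]
    refine Finset.sum_congr rfl fun S _ => ?_
    by_cases hS : i ∈ S <;> simp [hS]) x hx S₀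
  simp only [Pi.single_apply, ite_smul, zero_smul, Finset.sum_ite_eq', Finset.mem_univ,
    if_true] at this
  have hs := (isUnit_prod_of_sq hb hv S₀).smul_eq_zero (x := x S₀ • (1 : C))
  rw [smul_eq_mul, mul_smul_comm, mul_one] at hs
  simpa using hs.1 this

theorem exists_sq_eq_algebraMap [CharP C 2] {v : Fin m → C} {b : Fin m → F}
    (hv : ∀ i, v i * v i = algebraMap F C (b i))
    (hgen : Algebra.adjoin F (Set.range v) = ⊤) (c : C) :
    ∃ r : F, c ^ 2 = algebraMap F C r := by
  have hc : c ∈ Algebra.adjoin F (Set.range v) := hgen ▸ Algebra.mem_top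
  induction hc using Algebra.adjoin_induction with
  | mem x hx =>
    obtain ⟨i, rfl⟩ := hx
    exact ⟨b i, by rw [sq, hv]⟩
  | algebraMap r => exact ⟨r ^ 2, by simp⟩
  | add x y _ _ hx hy =>
    obtain ⟨r, hr⟩ := hx
    obtain ⟨s, hs⟩ := hy
    exact ⟨r + s, by rw [CharTwo.add_sq, hr, hs, map_add]⟩
  | mul x y _ _ hx hy =>
    obtain ⟨r, hr⟩ := hx
    obtain ⟨s, hs⟩ := hy
    exact ⟨r * s, by rw [mul_pow, hr, hs, map_mul]⟩

theorem isLocalRing_of_sq_mem [CharP C 2] [Nontrivial C]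
    (h : ∀ c : C, ∃ r : F, c ^ 2 = algebraMap F C r) : IsLocalRing C := by
  have key : ∀ c : C, c ∈ nonunits C ↔ c ^ 2 = 0 := by
    intro c
    obtain ⟨r, hr⟩ := h c
    constructor
    · intro hc
      by_cases h0 : r = 0
      · rw [hr, h0, map_zero]
      · exact absurd ((isUnit_pow_iff two_ne_zero).1
          (hr ▸ (IsUnit.mk0 r h0).map (algebraMap F C))) hc
    · intro h0 hc
      exact not_isUnit_zero (h0 ▸ hc.pow 2)
  refine IsLocalRing.of_nonunits_add fun x y hx hy => ?_
  rw [key] at *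
  rw [CharTwo.add_sq, hx, hy, add_zero]

open Module TensorProduct in
theorem exists_generators_coeff_mem_maximalIdeal {R M : Type*} [CommRing R] [IsLocalRing R]
    [AddCommGroup M] [Module R M] [Module.Finite R M] :
    ∃ (r : ℕ) (w : Fin r → M), Submodule.span R (Set.range w) = ⊤ ∧
      ∀ c : Fin r → R, ∑ l, c l • w l = 0 → ∀ l, c l ∈ IsLocalRing.maximalIdeal R := by
  let β := finBasis (IsLocalRing.ResidueField R) (IsLocalRing.ResidueField R ⊗[R] M)
  choose w hw using fun l => TensorProduct.mk_surjective R M (IsLocalRing.ResidueField R)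
    Ideal.Quotient.mk_surjective (β l)
  refine ⟨_, w, IsLocalRing.span_eq_top_of_tmul_eq_basis w β hw, fun c hc l => ?_⟩
  have h := congrArg (TensorProduct.mk R (IsLocalRing.ResidueField R) M 1) hc
  simp only [map_sum, map_smul, hw, map_zero] at h
  have h' : ∑ l, IsLocalRing.residue R (c l) • β l = 0 := by
    rw [← h]
    exact Finset.sum_congr rfl fun l _ => (IsScalarTower.algebraMap_smul _ _ _)
  exact (IsLocalRing.residue_eq_zero_iff _).1 (Fintype.linearIndependent_iff.1
    β.linearIndependent _ h' l)

open Module in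
theorem exists_smul_eq_zero_imp [CharP C 2] [FaithfulSMul C V] [Nontrivial V]
    [FiniteDimensional F V]
    {v : Fin m → C} {b : Fin m → F} {u : Fin m → V →ₗ[F] V} (hb : ∀ i, b i ≠ 0)
    (hv : ∀ i, v i * v i = algebraMap F C (b i))
    (hgen : Algebra.adjoin F (Set.range v) = ⊤)
    (huv : ∀ i j x, u i (v j • x) = v j • u i x + if i = j then v j • x else 0) :
    ∃ w : V, ∀ c : C, c • w = 0 → c = 0 := by
  have : Nontrivial C := Module.nontrivial C V
  have : IsLocalRing C := isLocalRing_of_sq_mem (exists_sq_eq_algebraMap hv hgen)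
  have : Module.Finite C V := Module.Finite.of_restrictScalars_finite F C V
  have hli := linearIndependent_prod hb hv huv
  let 𝓑 := Basis.mk hli (span_prod_eq_top hv hgen).ge
  have h𝓑 : ∀ S, 𝓑 S = ∏ i ∈ S, v i := fun S => by simp [𝓑]
  let D : Fin m → C →ₗ[F] C := fun i => 𝓑.constr F fun S => if i ∈ S then 𝓑 S else 0
  have hD : ∀ i S, D i (𝓑 S) = if i ∈ S then 𝓑 S else 0 := fun i S => 𝓑.constr_basis F _ S
  have hD' : ∀ i S, D i (∏ j ∈ S, v j) = if i ∈ S then ∏ j ∈ S, v j else 0 := fun i S => by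
    simpa only [h𝓑] using hD i S
  have huD : ∀ i c x, u i (c • x) = c • u i x + D i c • x := by
    intro i c x
    rw [← 𝓑.sum_repr c]
    simp only [Finset.sum_smul, map_sum, map_smul, smul_assoc, hD', h𝓑, map_prod_smul huv,
      smul_add, Finset.sum_add_distrib]
    congr 1
    refine Finset.sum_congr rfl fun S _ => ?_
    by_cases hS : i ∈ S <;> simp [hS]
  obtain ⟨r, w, hw, hrel⟩ := exists_generators_coeff_mem_maximalIdeal (R := C) (M := V)
  let J : Submodule F C := Submodule.span F {x | ∃ c : Fin r → C, ∑ l, c l • w l = 0 ∧ ∃ l, c l = x}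
  have hJmax : ∀ x ∈ J, x ∈ IsLocalRing.maximalIdeal C := by
    intro x hx
    refine (Submodule.span_le (p := (IsLocalRing.maximalIdeal C).restrictScalars F)).2 ?_ hx
    rintro _ ⟨c, hc, l, rfl⟩
    exact hrel c hc l
  have hJD : ∀ i, ∀ x ∈ J, D i x ∈ J := by
    intro i x hx
    refine (Submodule.span_le (p := J.comap (D i))).2 ?_ hx
    rintro _ ⟨c, hc, l, rfl⟩
    choose Γ hΓ using fun j => (Submodule.mem_span_range_iff_exists_fun C).1
      (hw ▸ Submodule.mem_top : u i (w j) ∈ Submodule.span C (Set.range w))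
    have hc' : ∑ l, (D i (c l) + ∑ j, c j * Γ j l) • w l = 0 := by
      have h : ∑ j, c j • u i (w j) = ∑ l, (∑ j, c j * Γ j l) • w l := by
        simp only [← hΓ, Finset.smul_sum, Finset.sum_smul, mul_smul]
        exact Finset.sum_comm
      have h' := congrArg (u i) hc
      simp only [map_sum, huD, Finset.sum_add_distrib, map_zero, h] at h'
      simpa only [add_smul, Finset.sum_add_distrib, add_comm] using h'
    have h1 : D i (c l) + ∑ j, c j * Γ j l ∈ J := Submodule.subset_span ⟨_, hc', l, rfl⟩
    have h2 : ∑ j, c j * Γ j l ∈ J := sum_mem fun j _ => Submodule.subset_span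
      ⟨fun l' => Γ j l * c l', by simp only [mul_smul, ← Finset.smul_sum, hc, smul_zero], j,
        mul_comm _ _⟩
    exact (Submodule.add_mem_iff_left _ h2).1 h1
  have hJ : ∀ x ∈ J, x = 0 := by
    intro x hx
    have h1 : ∀ (x : Finset (Fin m) → F) (i : Fin m), ∑ S, x S • 𝓑 S ∈ J →
        ∑ S, (if i ∈ S then x S else 0) • 𝓑 S ∈ J := by
      intro x i hx
      convert hJD i _ hx using 1
      simp only [map_sum, map_smul, hD]
      refine Finset.sum_congr rfl fun S _ => ?_
      by_cases hS : i ∈ S <;> simp [hS]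
    have key := filter_induction (fun x => ∑ S, x S • 𝓑 S ∈ J) h1 (fun x i hx => by
      convert sub_mem hx (h1 x i hx) using 1
      rw [← Finset.sum_sub_distrib]
      refine Finset.sum_congr rfl fun S _ => ?_
      by_cases hS : i ∈ S <;> simp [hS]) (𝓑.repr x) (by rwa [𝓑.sum_repr])
    refine 𝓑.repr.map_eq_zero_iff.1 (Finsupp.ext fun S₀ => ?_)
    have h := hJmax _ (key S₀)
    simp only [Pi.single_apply, ite_smul, zero_smul, Finset.sum_ite_eq', Finset.mem_univ,
      if_true, h𝓑] at h
    by_contra h0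
    refine (IsLocalRing.mem_maximalIdeal _).1 h ?_
    rw [Algebra.smul_def]
    exact ((IsUnit.mk0 _ h0).map _).mul (isUnit_prod_of_sq hb hv S₀)
  have hr : 0 < r := by
    by_contra h0
    obtain rfl : r = 0 := by omega
    rw [Set.range_eq_empty, Submodule.span_empty] at hw
    exact bot_ne_top hw
  refine ⟨w ⟨0, hr⟩, fun c hc => hJ c (Submodule.subset_span ⟨Pi.single ⟨0, hr⟩ c, ?_, ⟨0, hr⟩,
    by simp⟩)⟩
  rw [Finset.sum_eq_single ⟨0, hr⟩] <;> simp +contextual [hc]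

open Module in
/-- A representation of dimension `2 ^ m` of commuting quaternion relations has a cyclic vector
`w` for the `v i`, and the `u i` act on it through a single function `g`, up to scalars `e i`. -/
theorem exists_cyclic_vector [CharP C 2] [FaithfulSMul C V] (hdim : finrank F V = 2 ^ m)
    {v : Fin m → C} {b : Fin m → F} {u : Fin m → V →ₗ[F] V} (hb : ∀ i, b i ≠ 0)
    (hv : ∀ i, v i * v i = algebraMap F C (b i))
    (hgen : Algebra.adjoin F (Set.range v) = ⊤)
    (huv : ∀ i j x, u i (v j • x) = v j • u i x + if i = j then v j • x else 0)
    (huu : ∀ i j x, u i (u j x) = u j (u i x)) :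
    ∃ (w : V) (e : Fin m → F) (g : Finset (Fin m) → F),
      LinearIndependent F (fun S : Finset (Fin m) => (∏ i ∈ S, v i) • w) ∧
      ∀ i, u i w = e i • w + ∑ S with i ∈ S, g S • (∏ i ∈ S, v i) • w := by
  have hpos : 0 < finrank F V := by rw [hdim]; positivity
  have : FiniteDimensional F V := FiniteDimensional.of_finrank_pos hpos
  have : Nontrivial V := nontrivial_of_finrank_pos hpos
  have : Nontrivial C := Module.nontrivial C V
  obtain ⟨w, hw⟩ := exists_smul_eq_zero_imp hb hv hgen huv
  have hli := linearIndependent_prod hb hv huv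
  let 𝓑 := Basis.mk hli (span_prod_eq_top hv hgen).ge
  have h𝓑 : ∀ S, 𝓑 S = ∏ i ∈ S, v i := fun S => by simp [𝓑]
  let f : C →ₗ[F] V := (LinearMap.toSpanSingleton C V w).restrictScalars F
  have hf : Function.Injective f := (injective_iff_map_eq_zero f).2 hw
  have : FiniteDimensional F C := 𝓑.finiteDimensional_of_finite
  have hfs : Function.Surjective f :=
    (LinearMap.injective_iff_surjective_of_finrank_eq_finrank (by
      rw [hdim, finrank_eq_card_basis 𝓑]; simp)).1 hf
  choose c hc using fun i => hfs (u i w)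
  replace hc : ∀ i, c i • w = u i w := hc
  have key : ∀ i j S, (if i ∈ S then 𝓑.repr (c j) S else 0) =
      if j ∈ S then 𝓑.repr (c i) S else 0 := by
    have hu : ∀ i d, u i (d • w) = (∑ S, (if i ∈ S then 𝓑.repr d S else 0) • 𝓑 S) • w +
        (c i * d) • w := by
      intro i d
      have hd := 𝓑.sum_repr d
      generalize 𝓑.repr d = x at hd ⊢
      subst hd
      rw [mul_comm]
      simp only [Finset.sum_smul, map_sum, map_smul, smul_assoc, h𝓑, map_prod_smul huv,
        smul_add, Finset.sum_add_distrib, ← hc, Finset.sum_mul, smul_mul_assoc, mul_smul]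
      rw [add_comm]
      congr 1
      refine Finset.sum_congr rfl fun S _ => ?_
      by_cases hS : i ∈ S <;> simp [hS]
    intro i j S
    have h := huu i j w
    rw [← hc j, ← hc i, hu, hu, mul_comm (c j), add_left_inj, ← sub_eq_zero, ← sub_smul] at h
    have h' := congrArg (fun x => 𝓑.repr x S) (sub_eq_zero.1 (hw _ h))
    simpa only [𝓑.repr_sum_self] using h'
  refine ⟨w, fun i => 𝓑.repr (c i) ∅,
    fun S => if h : ∃ i, i ∈ S then 𝓑.repr (c h.choose) S else 0, ?_, fun i => ?_⟩
  · exact hli.map' f (LinearMap.ker_eq_bot.2 hf)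
  · rw [← hc i]
    conv_lhs => rw [← 𝓑.sum_repr (c i), Finset.sum_smul,
      ← Finset.add_sum_erase _ _ (Finset.mem_univ ∅)]
    congr 1
    · simp [h𝓑]
    · symm
      refine Finset.sum_subset_zero_on_sdiff (fun S hS => ?_) (fun S hS => ?_) (fun S hS => ?_)
      · simp only [Finset.mem_filter, Finset.mem_univ, true_and] at hS
        exact Finset.mem_erase.2 ⟨Finset.ne_empty_of_mem hS, Finset.mem_univ _⟩
      · simp only [Finset.mem_sdiff, Finset.mem_erase, Finset.mem_univ, Finset.mem_filter,
          true_and, and_true] at hS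
        obtain ⟨j, hj⟩ := Finset.nonempty_iff_ne_empty.2 hS.1
        have h := key i j S
        rw [if_neg hS.2, if_pos hj] at h
        rw [← h, zero_smul, zero_smul]
      · simp only [Finset.mem_filter, Finset.mem_univ, true_and] at hS
        have hne : ∃ i, i ∈ S := ⟨i, hS⟩
        have h := key i hne.choose S
        rw [if_pos hS, if_pos hne.choose_spec] at h
        beta_reduce
        rw [dif_pos hne, h, h𝓑, smul_assoc]

end SquareRootAlgebra

theorem trdeg_adjoin_le (k : Type*) {F : Type*} [Field k] [Field F] [Algebra k F] (s : Set F) :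
    trdeg k (IntermediateField.adjoin k s) ≤ Cardinal.mk s := by
  let t : Set (IntermediateField.adjoin k s) := Subtype.val ⁻¹' s
  have hadj : ∀ y ∈ Algebra.adjoin k s, ∃ z ∈ Algebra.adjoin k t, (z : F) = y := by
    intro y hy
    have hst : s = (IntermediateField.adjoin k s).val '' t := by
      ext y
      constructor
      · exact fun hy => ⟨⟨y, IntermediateField.subset_adjoin k s hy⟩, hy, rfl⟩
      · rintro ⟨z, hz, rfl⟩
        exact hz
    rw [hst, ← AlgHom.map_adjoin] at hy
    exact hy
  have halg : Algebra.IsAlgebraic (Algebra.adjoin k t) (IntermediateField.adjoin k s) := by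
    refine ⟨fun x => ?_⟩
    obtain ⟨y, hy, z, hz, h⟩ := IntermediateField.mem_adjoin_iff_div.1 x.2
    obtain ⟨y', hy', rfl⟩ := hadj y hy
    obtain ⟨z', hz', rfl⟩ := hadj z hz
    obtain rfl : x = y' / z' := Subtype.ext h
    rw [div_eq_mul_inv]
    exact (isAlgebraic_algebraMap (⟨y', hy'⟩ : Algebra.adjoin k t)).mul
      (isAlgebraic_algebraMap (⟨z', hz'⟩ : Algebra.adjoin k t)).inv
  exact (Algebra.IsAlgebraic.trdeg_le_cardinalMk k t).trans
    (Cardinal.mk_preimage_of_injective _ _ Subtype.val_injective)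

namespace QuatAlg

variable {F : Type*} [Field F] {a b : F}

variable (a b) in
/-- The projection from the free algebra. -/
def proj : FreeAlgebra F (Fin 2) →ₐ[F] QuatAlg F a b := RingQuot.mkAlgHom F (QuatRel F a b)

variable (a b) in
/-- The generator `u` of `[a,b)`. -/
def u : QuatAlg F a b := proj a b (FreeAlgebra.ι F 0)

variable (a b) in
/-- The generator `v` of `[a,b)`. -/
def v : QuatAlg F a b := proj a b (FreeAlgebra.ι F 1)

theorem proj_surjective : Function.Surjective (proj a b) := RingQuot.mkAlgHom_surjective F _

theorem proj_eq {x y : FreeAlgebra F (Fin 2)} (h : QuatRel F a b x y) :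
    proj a b x = proj a b y := RingQuot.mkAlgHom_rel F h

theorem u_sq : u a b * u a b - u a b = algebraMap F _ a := by
  have h := proj_eq (QuatRel.u_sq (a := a) (b := b))
  simp only [map_sub, map_mul, AlgHom.commutes] at h
  exact h

theorem v_sq : v a b * v a b = algebraMap F _ b := by
  have h := proj_eq (QuatRel.v_sq (a := a) (b := b))
  simp only [map_mul, AlgHom.commutes] at h
  exact h

theorem v_mul_u : v a b * u a b = (1 - u a b) * v a b := by
  have h := proj_eq (QuatRel.vu (a := a) (b := b))
  simp only [map_sub, map_mul, map_one] at h
  exact h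

variable {B : Type*} [Ring B] [Algebra F B]

/-- The universal property of `[a,b)`. -/
def lift (U V : B) (hU : U * U - U = algebraMap F B a) (hV : V * V = algebraMap F B b)
    (hVU : V * U = (1 - U) * V) : QuatAlg F a b →ₐ[F] B :=
  RingQuot.liftAlgHom F ⟨FreeAlgebra.lift F ![U, V], by rintro _ _ (_ | _ | _) <;> simp [*]⟩

theorem lift_proj (U V : B) (hU hV hVU) (x) :
    lift (a := a) (b := b) U V hU hV hVU (proj a b x) = FreeAlgebra.lift F ![U, V] x :=
  RingQuot.liftAlgHom_mkAlgHom_apply _ _ _ _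

theorem lift_u (U V : B) (hU hV hVU) : lift (a := a) (b := b) U V hU hV hVU (u a b) = U :=
  (lift_proj U V hU hV hVU _).trans (by simp)

theorem lift_v (U V : B) (hU hV hVU) : lift (a := a) (b := b) U V hU hV hVU (v a b) = V :=
  (lift_proj U V hU hV hVU _).trans (by simp)

theorem algHom_ext {f g : QuatAlg F a b →ₐ[F] B} (hu : f (u a b) = g (u a b))
    (hv : f (v a b) = g (v a b)) : f = g := by
  have h : f.comp (proj a b) = g.comp (proj a b) := by
    refine FreeAlgebra.hom_ext (funext fun i => ?_)
    fin_cases i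
    · exact hu
    · exact hv
  ext x
  obtain ⟨y, rfl⟩ := proj_surjective x
  exact DFunLike.congr_fun h y

variable (a b) in
/-- The standard spanning family `1, u, v, uv`. -/
def gens : Fin 4 → QuatAlg F a b := ![1, u a b, v a b, u a b * v a b]

theorem span_range_gens : Submodule.span F (Set.range (gens a b)) = ⊤ := by
  set N := Submodule.span F (Set.range (gens a b))
  have h0 : 1 ∈ N := Submodule.subset_span ⟨0, rfl⟩
  have h1 : u a b ∈ N := Submodule.subset_span ⟨1, rfl⟩
  have h2 : v a b ∈ N := Submodule.subset_span ⟨2, rfl⟩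
  have h3 : u a b * v a b ∈ N := Submodule.subset_span ⟨3, rfl⟩
  have huu : u a b * u a b = u a b + a • 1 := by
    rw [← Algebra.algebraMap_eq_smul_one, ← u_sq (b := b)]; abel
  have hvv : v a b * v a b = b • 1 := by
    rw [← Algebra.algebraMap_eq_smul_one, ← v_sq (a := a)]
  have hu : ∀ y ∈ N, u a b * y ∈ N := by
    intro y hy
    refine (Submodule.span_le (p := N.comap (LinearMap.mulLeft F (u a b)))).2 ?_ hy
    rintro _ ⟨j, rfl⟩
    fin_cases j
    · simpa [gens] using h1
    · simpa [gens, huu] using add_mem h1 (N.smul_mem a h0)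
    · simpa [gens] using h3
    · simpa [gens, ← mul_assoc, huu, add_mul] using add_mem h3 (N.smul_mem a h2)
  have hv : ∀ y ∈ N, v a b * y ∈ N := by
    intro y hy
    refine (Submodule.span_le (p := N.comap (LinearMap.mulLeft F (v a b)))).2 ?_ hy
    rintro _ ⟨j, rfl⟩
    fin_cases j
    · simpa [gens] using h2
    · simpa [gens, v_mul_u, sub_mul] using sub_mem h2 h3
    · simpa [gens, hvv] using N.smul_mem b h0
    · simpa [gens, ← mul_assoc, v_mul_u, sub_mul, mul_assoc _ (v a b) (v a b), hvv] using
        sub_mem (N.smul_mem b h0) (N.smul_mem b h1)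
  have key : ∀ z y, y ∈ N → proj a b z * y ∈ N := by
    intro z
    induction z using FreeAlgebra.induction with
    | grade0 r =>
      intro y hy
      rw [AlgHom.commutes, ← Algebra.smul_def]
      exact N.smul_mem r hy
    | grade1 i =>
      fin_cases i
      · exact hu
      · exact hv
    | mul p q hp hq =>
      intro y hy
      rw [map_mul, mul_assoc]
      exact hp _ (hq _ hy)
    | add p q hp hq =>
      intro y hy
      rw [map_add, add_mul]
      exact add_mem (hp _ hy) (hq _ hy)
  rw [eq_top_iff]
  intro y _
  obtain ⟨z, rfl⟩ := proj_surjective y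
  simpa using key z 1 h0

theorem shift_relations [CharP F 2] (e : F) :
    (u a b + algebraMap F _ e) * (u a b + algebraMap F _ e) - (u a b + algebraMap F _ e) =
        algebraMap F _ (a + e ^ 2 + e) ∧
      v a b * (u a b + algebraMap F _ e) = (1 - (u a b + algebraMap F _ e)) * v a b := by
  have h2 : ∀ x : QuatAlg F a b, x + x = 0 := fun x => by
    rw [← two_smul F, CharTwo.two_eq_zero, zero_smul]
  have hneg : ∀ x : QuatAlg F a b, -x = x := fun x => neg_eq_of_add_eq_zero_left (h2 x)
  have hc := Algebra.commutes e (u a b)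
  have hc' := Algebra.commutes e (v a b)
  constructor
  · have h : (u a b + algebraMap F _ e) * (u a b + algebraMap F _ e) -
        (u a b + algebraMap F _ e) = u a b * u a b - u a b + algebraMap F _ e * algebraMap F _ e +
          algebraMap F _ e + ((u a b * algebraMap F _ e + u a b * algebraMap F _ e) -
            (algebraMap F _ e + algebraMap F _ e)) := by
      rw [mul_add, add_mul, add_mul, hc]
      abel
    rw [h, h2, h2, sub_zero, add_zero, u_sq, map_add, map_add, map_pow, sq]
  · rw [mul_add, v_mul_u, ← hc', sub_mul, sub_mul, add_mul, sub_add_eq_sub_sub,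
      sub_eq_add_neg _ (algebraMap F _ e * _), hneg]

/-- `[a + e² + e, b) ≅ [a, b)` through `u ↦ u + e`. -/
theorem exists_shift_equiv [CharP F 2] {a' : F} (e : F) (ha : a' = a + e ^ 2 + e) :
    ∃ σ : QuatAlg F a' b ≃ₐ[F] QuatAlg F a b,
      σ (u a' b) = u a b + algebraMap F _ e ∧ σ (v a' b) = v a b := by
  subst ha
  have hinv : a + e ^ 2 + e + e ^ 2 + e = a := by
    linear_combination (e ^ 2 + e) * CharTwo.two_eq_zero (R := F)
  have h2 : ∀ {c : F} (x : QuatAlg F c b), x + algebraMap F _ e + algebraMap F _ e = x := fun x => by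
    rw [add_assoc, ← map_add, CharTwo.add_self_eq_zero, map_zero, add_zero]
  obtain ⟨h₁, h₂⟩ := shift_relations (a := a) (b := b) e
  obtain ⟨h₃, h₄⟩ := shift_relations (a := a + e ^ 2 + e) (b := b) e
  rw [hinv] at h₃
  refine ⟨AlgEquiv.ofAlgHom (lift _ _ h₁ v_sq h₂) (lift _ _ h₃ v_sq h₄) (algHom_ext ?_ ?_)
    (algHom_ext ?_ ?_), lift_u _ _ h₁ v_sq h₂, lift_v _ _ h₁ v_sq h₂⟩ <;>
    simp only [AlgHom.comp_apply, AlgHom.id_apply, lift_u, lift_v, map_add, AlgHom.commutes, h2]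

/-- Extension of scalars `[a,b)_L → [a,b)_F`. -/
theorem exists_baseChange {L : Type*} [Field L] [Algebra L F] (a b : L) :
    ∃ f : QuatAlg L a b →+* QuatAlg F (algebraMap L F a) (algebraMap L F b),
      (∀ l, f (algebraMap L _ l) = algebraMap F _ (algebraMap L F l)) ∧
      f (u a b) = u _ _ ∧ f (v a b) = v _ _ := by
  let _ : Algebra L (QuatAlg F (algebraMap L F a) (algebraMap L F b)) :=
    Algebra.compHom _ (algebraMap L F)
  exact ⟨(lift (B := QuatAlg F (algebraMap L F a) (algebraMap L F b)) (u _ _) (v _ _)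
    u_sq v_sq v_mul_u : QuatAlg L a b →ₐ[L] _), fun l => AlgHom.commutes _ l,
    lift_u _ _ _ _ _, lift_v _ _ _ _ _⟩

end QuatAlg

open scoped IsMulCommutative in
theorem exists_basis_repr_mem {F V : Type*} [Field F] [CharP F 2] [AddCommGroup V] [Module F V]
    {m : ℕ} (hdim : Module.finrank F V = 2 ^ m) {b : Fin m → F} (hb : ∀ i, b i ≠ 0)
    {U W : Fin m → Module.End F V} (hWb : ∀ i, W i * W i = algebraMap F _ (b i))
    (hWU : ∀ i, W i * U i = (1 - U i) * W i) (hWW : ∀ i j, Commute (W i) (W j))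
    (hUU : ∀ i j, Commute (U i) (U j)) (hUW : ∀ i j, i ≠ j → Commute (U i) (W j)) :
    ∃ (B : Module.Basis (Finset (Fin m)) F V) (e : Fin m → F) (g : Finset (Fin m) → F),
      ∀ K : Subfield F, (∀ i, b i ∈ K) → (∀ S, g S ∈ K) → ∀ i S T,
        B.repr (W i (B S)) T ∈ K ∧ B.repr (U i (B S) + e i • B S) T ∈ K := by
  have h2 : ∀ x : V, x + x = 0 := fun x => by
    rw [← two_smul F, CharTwo.two_eq_zero, zero_smul]
  have : Nontrivial V := Module.nontrivial_of_finrank_pos (R := F) (by rw [hdim]; positivity)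
  obtain ⟨C, hC⟩ : ∃ C : Subalgebra F (Module.End F V), C = Algebra.adjoin F (Set.range W) :=
    ⟨_, rfl⟩
  have : IsMulCommutative C := hC ▸ Algebra.isMulCommutative_adjoin F (s := Set.range W) (by
    rintro _ ⟨i, rfl⟩ _ ⟨j, rfl⟩
    exact hWW i j)
  let v : Fin m → C := fun i => ⟨W i, hC ▸ Algebra.subset_adjoin ⟨i, rfl⟩⟩
  have hgen : Algebra.adjoin F (Set.range v) = ⊤ := by
    apply Subalgebra.map_injective (f := C.val) Subtype.val_injective
    rw [AlgHom.map_adjoin, ← Set.range_comp, Algebra.map_top, Subalgebra.range_val]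
    exact hC.symm
  have : CharP C 2 := charP_of_injective_algebraMap (algebraMap F C).injective 2
  have : FaithfulSMul C V := ⟨fun h => Subtype.ext (LinearMap.ext h)⟩
  have hv : ∀ i, v i * v i = algebraMap F C (b i) := fun i => Subtype.ext (hWb i)
  have hvW : ∀ i x, v i • x = W i x := fun i x => rfl
  have huv : ∀ i j x, U i (v j • x) = v j • U i x + if i = j then v j • x else 0 := by
    intro i j x
    simp only [hvW]
    split_ifs with hij
    · subst hij
      have h := DFunLike.congr_fun (hWU i) x
      simp only [Module.End.mul_apply, LinearMap.sub_apply, Module.End.one_apply] at h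
      rw [h, sub_add_eq_add_sub, h2, zero_sub]
      exact (neg_eq_of_add_eq_zero_left (h2 _)).symm
    · rw [add_zero]
      exact DFunLike.congr_fun (hUW i j hij) x
  obtain ⟨w, e, g, hli, hw⟩ := exists_cyclic_vector (C := C) (v := v) hdim hb hv hgen huv
    (fun i j x => DFunLike.congr_fun (hUU i j) x)
  let B := basisOfLinearIndependentOfCardEqFinrank hli (by simp [hdim])
  have hB : ∀ S, B S = (∏ i ∈ S, v i) • w := fun S => by simp [B]
  refine ⟨B, e, g, fun K hbK hgK i S T => ?_⟩
  have hmul : ∀ S T, (∏ i ∈ S, v i) • B T = (∏ i ∈ S ∩ T, b i) • B (symmDiff S T) := by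
    intro S T
    rw [hB, hB, smul_smul, prod_mul_prod_eq_symmDiff hv, smul_assoc]
  have hprod : ∀ S : Finset (Fin m), ∏ i ∈ S, b i ∈ K := fun S => prod_mem fun i _ => hbK i
  have hrepr : ∀ (c : F) (_ : c ∈ K) S, B.repr (c • B S) T ∈ K := by
    intro c hc S
    rw [map_smul, B.repr_self, Finsupp.smul_single, Finsupp.single_apply]
    split_ifs
    · simpa using hc
    · exact zero_mem K
  constructor
  · have h := hmul {i} S
    rw [Finset.prod_singleton, hvW] at h
    rw [h]
    exact hrepr _ (hprod _) _
  · have h : U i (B S) + e i • B S = (if i ∈ S then B S else 0) +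
        ∑ T with i ∈ T, (g T * ∏ i ∈ S ∩ T, b i) • B (symmDiff S T) := by
      conv_lhs => rw [hB, map_prod_smul huv, hw, smul_add, smul_comm (∏ i ∈ S, v i) (e i), ← hB]
      rw [Finset.smul_sum]
      have : ∀ T, (∏ i ∈ S, v i) • g T • (∏ i ∈ T, v i) • w =
          (g T * ∏ i ∈ S ∩ T, b i) • B (symmDiff S T) := fun T => by
        rw [← hB, smul_comm, hmul, smul_smul]
      simp only [this]
      rw [add_right_comm, add_right_comm (e i • B S), h2, zero_add, add_comm]
    rw [h, map_add, map_sum, Finsupp.add_apply, Finsupp.finsetSum_apply]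
    refine add_mem ?_ (sum_mem fun T' _ => hrepr _ (mul_mem (hgK T') (hprod _)) _)
    split_ifs
    · simpa using hrepr 1 (one_mem K) S
    · simp

theorem tprod_eq_noncommProd {K : Type*} [CommRing K] {m : ℕ} {A : Fin m → Type*}
    [∀ i, Ring (A i)] [∀ i, Algebra K (A i)] (x : ∀ i, A i) :
    PiTensorProduct.tprod K x = Finset.univ.noncommProd
      (fun i => PiTensorProduct.singleAlgHom (R := K) i (x i)) (fun i _ j _ _ =>
        Commute.tprod (Pi.mulSingle_apply_commute x i j)) :=
  (congrArg _ (Finset.noncommProd_mulSingle x).symm).trans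
    (PiTensorProduct.tprod_noncommProd _ _ _)

section Descent

variable {L F : Type*} [Field L] [Field F] [Algebra L F] {m : ℕ} {R Q : Fin m → Type*}
  [∀ i, Ring (R i)] [∀ i, Algebra L (R i)] [∀ i, Ring (Q i)] [∀ i, Algebra F (Q i)]
  {n : Type*} [Fintype n] [DecidableEq n]

/-- The `L`-algebra map induced by semilinear ring maps on the factors. -/
theorem exists_algHom_tprod (Φ : (⨂[F] i, Q i) ≃ₐ[F] Matrix n n F) (j : ∀ i, R i →+* Q i)
    (hj : ∀ i l, j i (algebraMap L _ l) = algebraMap F _ (algebraMap L F l)) :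
    ∃ Ψ : (⨂[L] i, R i) →ₐ[L] Matrix n n F, ∀ x,
      Ψ (PiTensorProduct.tprod L x) = Φ (PiTensorProduct.tprod F fun i => j i (x i)) := by
  have hsmul : ∀ i l y, j i (l • y) = algebraMap L F l • j i y := fun i l y => by
    rw [Algebra.smul_def, map_mul, hj, ← Algebra.smul_def]
  have hupd : ∀ [DecidableEq (Fin m)] (x : ∀ i, R i) i y,
      (fun k => j k (Function.update x i y k)) =
        Function.update (fun k => j k (x k)) i (j i y) := fun x i y =>
    funext fun k => Function.apply_update (fun k => j k) x i y k
  let f : MultilinearMap L R (Matrix n n F) :=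
    { toFun := fun x => Φ (PiTensorProduct.tprod F fun i => j i (x i))
      map_update_add' := by
        intro _ x i y z
        simp only [hupd, map_add, MultilinearMap.map_update_add]
      map_update_smul' := by
        intro _ x i l y
        rw [hupd, hupd, hsmul, MultilinearMap.map_update_smul, map_smul, algebraMap_smul] }
  refine ⟨PiTensorProduct.liftAlgHom f ?_ ?_, fun x => PiTensorProduct.lift.tprod x⟩
  · refine Eq.trans (congrArg Φ ?_) (map_one Φ)
    exact congrArg (PiTensorProduct.tprod F) (funext fun i => map_one (j i))
  · intro x y
    refine Eq.trans (congrArg Φ ?_) (map_mul Φ _ _)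
    rw [PiTensorProduct.tprod_mul_tprod]
    exact congrArg (PiTensorProduct.tprod F) (funext fun i => map_mul (j i) _ _)

theorem nonempty_algEquiv_matrix_of_descends (Φ : (⨂[F] i, Q i) ≃ₐ[F] Matrix n n F)
    (hn : Fintype.card n = 2 ^ m) (j : ∀ i, R i →+* Q i)
    (hj : ∀ i l, j i (algebraMap L _ l) = algebraMap F _ (algebraMap L F l))
    (γ : ∀ i, Fin 4 → R i) (hγ : ∀ i, Submodule.span L (Set.range (γ i)) = ⊤)
    (hγ' : ∀ i, Submodule.span F (Set.range fun t => j i (γ i t)) = ⊤)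
    (h : ∀ i t, Φ (PiTensorProduct.singleAlgHom i (j i (γ i t))) ∈
      (Algebra.ofId L F).mapMatrix.range (A := Matrix n n L)) :
    Nonempty ((⨂[L] i, R i) ≃ₐ[L] Matrix n n L) := by
  obtain ⟨Ψ, hΨ⟩ := exists_algHom_tprod Φ j hj
  set S := (Algebra.ofId L F).mapMatrix.range (A := Matrix n n L)
  have hsingle : ∀ i (x : R i), Ψ (PiTensorProduct.singleAlgHom i x) ∈ S := by
    intro i x
    have hx : x ∈ Submodule.span L (Set.range (γ i)) := hγ i ▸ Submodule.mem_top
    refine (Submodule.span_le (p := (S.comap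
      (Ψ.comp (PiTensorProduct.singleAlgHom i))).toSubmodule)).2 ?_ hx
    rintro _ ⟨t, rfl⟩
    have heq : Ψ (PiTensorProduct.singleAlgHom i (γ i t)) =
        Φ (PiTensorProduct.singleAlgHom i (j i (γ i t))) := by
      refine (hΨ _).trans (congrArg (fun y => Φ (PiTensorProduct.tprod F y)) ?_)
      exact funext fun k => Pi.apply_mulSingle (fun k => j k) (fun k => map_one (j k)) i _ k
    exact (heq ▸ h i t : Ψ _ ∈ S)
  have hS : ∀ z, Ψ z ∈ S := by
    intro z
    have hz : z ∈ Submodule.span L (Set.range (PiTensorProduct.tprod L)) :=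
      PiTensorProduct.span_tprod_eq_top (R := L) (s := R) ▸ Submodule.mem_top
    refine (Submodule.span_le (p := (S.comap Ψ).toSubmodule)).2 ?_ hz
    rintro _ ⟨x, rfl⟩
    rw [tprod_eq_noncommProd]
    exact Submonoid.noncommProd_mem (S.comap Ψ).toSubmonoid _ _ _ fun i _ => hsingle i (x i)
  have hinj : Function.Injective ((Algebra.ofId L F).mapMatrix : Matrix n n L →ₐ[L] _) :=
    Matrix.map_injective (algebraMap L F).injective
  let E : Matrix n n L ≃ₐ[L] S := AlgEquiv.ofInjective _ hinj
  let Ψ' : (⨂[L] i, R i) →ₐ[L] S := Ψ.codRestrict S hS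
  have hcard : Fintype.card (Fin m → Fin 4) = Fintype.card n * Fintype.card n := by
    simp [hn, ← mul_pow]
  have hliF : LinearIndependent F fun s : Fin m → Fin 4 =>
      PiTensorProduct.tprod F fun i => j i (γ i (s i)) := by
    refine linearIndependent_of_top_le_span_of_card_eq_finrank
      (PiTensorProduct.submodule_span_eq_top (g := fun {i} t => j i (γ i t)) hγ').ge ?_
    rw [hcard, Φ.toLinearEquiv.finrank_eq, Module.finrank_matrix, Module.finrank_self, mul_one]
  have hli : LinearIndependent L fun s : Fin m → Fin 4 =>
      Ψ' (PiTensorProduct.tprod L fun i => γ i (s i)) := by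
    apply LinearIndependent.of_comp S.val.toLinearMap
    have h1 := (hliF.map' Φ.toLinearMap (LinearMap.ker_eq_bot.2 Φ.injective)).restrict_scalars'
      (R := L)
    have h2 : (S.val.toLinearMap ∘ fun s : Fin m → Fin 4 => Ψ' (PiTensorProduct.tprod L fun i => γ i (s i))) =
        Φ.toLinearMap ∘ fun s : Fin m → Fin 4 => PiTensorProduct.tprod F fun i => j i (γ i (s i)) :=
      funext fun s => hΨ _
    rw [h2]
    exact h1
  have hsp := PiTensorProduct.submodule_span_eq_top (g := fun {i} => γ i) hγ
  have hfin : Fintype.card (Fin m → Fin 4) = Module.finrank L S := by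
    rw [hcard, ← E.toLinearEquiv.finrank_eq, Module.finrank_matrix, Module.finrank_self, mul_one]
  have : Module.Finite L S := Module.Finite.equiv E.toLinearEquiv
  have hbij : Function.Bijective Ψ' := by
    constructor
    · rw [injective_iff_map_eq_zero]
      intro z hz
      obtain ⟨c, rfl⟩ := (Submodule.mem_span_range_iff_exists_fun L).1
        (hsp ▸ Submodule.mem_top : z ∈ _)
      simp only [map_sum, map_smul] at hz
      simp [Fintype.linearIndependent_iff.1 hli c hz]
    · intro y
      have hy : y ∈ Submodule.span L (Set.range fun s : Fin m → Fin 4 =>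
          Ψ' (PiTensorProduct.tprod L fun i => γ i (s i))) :=
        hli.span_eq_top_of_card_eq_finrank' hfin ▸ Submodule.mem_top
      obtain ⟨c, rfl⟩ := (Submodule.mem_span_range_iff_exists_fun L).1 hy
      exact ⟨∑ s, c s • PiTensorProduct.tprod L fun i => γ i (s i), by simp⟩
  exact ⟨(AlgEquiv.ofBijective Ψ' hbij).trans E.symm⟩

end Descent

theorem mem_range_mapMatrix_ofId {L F n : Type*} [Field L] [Field F] [Algebra L F] [Fintype n]
    [DecidableEq n] {M : Matrix n n F} (h : ∀ i j, M i j ∈ (algebraMap L F).range) :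
    M ∈ (Algebra.ofId L F).mapMatrix.range (A := Matrix n n L) := by
  choose N hN using h
  exact ⟨Matrix.of N, Matrix.ext hN⟩

theorem mem_of_mem_range_mapMatrix_ofId {L F n : Type*} [Field L] [Field F] [Algebra L F]
    [Fintype n] [DecidableEq n] {M : Matrix n n F}
    (h : M ∈ (Algebra.ofId L F).mapMatrix.range (A := Matrix n n L)) (i j : n) :
    M i j ∈ (algebraMap L F).range := by
  obtain ⟨N, rfl⟩ := h
  exact ⟨N i j, rfl⟩

section

variable {F : Type*} [Field F] {m : ℕ} {a b : Fin m → F}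

theorem commute_singleAlgHom {i j : Fin m} (hij : i ≠ j) (x : QuatAlg F (a i) (b i))
    (y : QuatAlg F (a j) (b j)) :
    Commute (PiTensorProduct.singleAlgHom (R := F) (A := fun i => QuatAlg F (a i) (b i)) i x)
      (PiTensorProduct.singleAlgHom j y) :=
  Commute.tprod (Pi.mulSingle_commute (f := fun i => QuatAlg F (a i) (b i)) hij x y)

/-- If a tensor product of quaternion algebras is split, then after replacing each generator `u i`
by `u i + e i`, all generators act by matrices with entries in any subfield containing finitely
many prescribed elements. -/
theorem exists_matrix_repr_mem [CharP F 2] (hb : ∀ i, b i ≠ 0)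
    (Φ : (⨂[F] i, QuatAlg F (a i) (b i)) ≃ₐ[F] Matrix (Fin (2 ^ m)) (Fin (2 ^ m)) F) :
    ∃ (Φ' : (⨂[F] i, QuatAlg F (a i) (b i)) ≃ₐ[F]
        Matrix (Finset (Fin m)) (Finset (Fin m)) F) (e : Fin m → F) (g : Finset (Fin m) → F),
      ∀ K : Subfield F, (∀ i, b i ∈ K) → (∀ S, g S ∈ K) → ∀ i S T,
        Φ' (PiTensorProduct.singleAlgHom i (QuatAlg.v (a i) (b i))) S T ∈ K ∧
        Φ' (PiTensorProduct.singleAlgHom i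
          (QuatAlg.u (a i) (b i) + algebraMap F _ (e i))) S T ∈ K := by
  let φ := Φ.trans (Matrix.toLinAlgEquiv' (R := F))
  have hcomm : ∀ (x y : ∀ i, QuatAlg F (a i) (b i)) (i j : Fin m), i ≠ j →
      Commute (φ (PiTensorProduct.singleAlgHom i (x i)))
        (φ (PiTensorProduct.singleAlgHom j (y j))) := fun x y i j hij =>
    (commute_singleAlgHom hij _ _).map φ
  have hcomm' : ∀ (x : ∀ i, QuatAlg F (a i) (b i)) (i j : Fin m),
      Commute (φ (PiTensorProduct.singleAlgHom i (x i)))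
        (φ (PiTensorProduct.singleAlgHom j (x j))) := fun x i j => by
    by_cases hij : i = j
    · subst hij
      exact Commute.refl _
    · exact hcomm x x i j hij
  obtain ⟨B, e, g, h⟩ := exists_basis_repr_mem (F := F) (V := Fin (2 ^ m) → F) (m := m) (by simp)
    hb (U := fun i => φ (PiTensorProduct.singleAlgHom i (QuatAlg.u (a i) (b i))))
    (W := fun i => φ (PiTensorProduct.singleAlgHom i (QuatAlg.v (a i) (b i))))
    (fun i => by
      simp only [← map_mul, QuatAlg.v_sq, AlgHom.commutes, AlgEquiv.commutes])
    (fun i => by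
      rw [← map_mul, ← map_mul, QuatAlg.v_mul_u, map_mul, map_mul, map_sub, map_sub, map_one,
        map_one])
    (hcomm' _) (hcomm' _) (hcomm _ _)
  refine ⟨φ.trans (LinearMap.toMatrixAlgEquiv B), e, g, fun K hbK hgK i S T => ?_⟩
  obtain ⟨h₁, h₂⟩ := h K hbK hgK i T S
  have hmat : ∀ x, φ.trans (LinearMap.toMatrixAlgEquiv B) x S T = B.repr (φ x (B T)) S := fun x =>
    LinearMap.toMatrixAlgEquiv_apply B (φ x) S T
  refine ⟨hmat _ ▸ h₁, ?_⟩
  rw [hmat, map_add, map_add, AlgHom.commutes, AlgEquiv.commutes, LinearMap.add_apply,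
    Module.algebraMap_end_apply]
  exact h₂

end

set_option maxSynthPendingDepth 3 in
set_option maxHeartbeats 1000000 in
set_option synthInstance.maxHeartbeats 1000000 in
theorem stmt6 (k F : Type*) [Field k] [Field F] [Algebra k F] [CharP k 2]
    (m : ℕ) (hm : 1 ≤ m) (a b : Fin m → F) (hb : ∀ i, b i ≠ 0)
    (hsplit : Nonempty
      ((⨂[F] i, QuatAlg F (a i) (b i)) ≃ₐ[F] Matrix (Fin (2 ^ m)) (Fin (2 ^ m)) F)) :
    ∃ L : IntermediateField k F, trdeg k L ≤ 2 ^ m + m ∧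
      ∃ a' b' : Fin m → L, (∀ i, b' i ≠ 0) ∧
        (∀ i, Nonempty (QuatAlg F (a' i : F) (b' i : F) ≃ₐ[F] QuatAlg F (a i) (b i))) ∧
        Nonempty
          ((⨂[L] i, QuatAlg L (a' i) (b' i)) ≃ₐ[L] Matrix (Fin (2 ^ m)) (Fin (2 ^ m)) L) := by
  have : CharP F 2 := charP_of_injective_algebraMap (algebraMap k F).injective 2
  obtain ⟨Φ₀⟩ := hsplit
  obtain ⟨Φ, e, g, h⟩ := exists_matrix_repr_mem hb Φ₀
  let L := IntermediateField.adjoin k (Set.range g ∪ Set.range b)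
  have hbL : ∀ i, b i ∈ L := fun i => IntermediateField.subset_adjoin _ _ (Or.inr ⟨i, rfl⟩)
  have hgL : ∀ S, g S ∈ L := fun S => IntermediateField.subset_adjoin _ _ (Or.inl ⟨S, rfl⟩)
  have hrange : ∀ x ∈ L, x ∈ (algebraMap L F).range := fun x hx => ⟨⟨x, hx⟩, rfl⟩
  let S := (Algebra.ofId L F).mapMatrix.range (A := Matrix (Finset (Fin m)) (Finset (Fin m)) L)
  have hv : ∀ i, Φ (PiTensorProduct.singleAlgHom i (QuatAlg.v (a i) (b i))) ∈ S := fun i =>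
    mem_range_mapMatrix_ofId fun p q => hrange _ (h L.toSubfield hbL hgL i p q).1
  have hu : ∀ i, Φ (PiTensorProduct.singleAlgHom i
      (QuatAlg.u (a i) (b i) + algebraMap F _ (e i))) ∈ S := fun i =>
    mem_range_mapMatrix_ofId fun p q => hrange _ (h L.toSubfield hbL hgL i p q).2
  have haL : ∀ i, a i + e i ^ 2 + e i ∈ L := by
    intro i
    have h₁ := sub_mem (mul_mem (hu i) (hu i)) (hu i)
    rw [← map_mul, ← map_mul, ← map_sub, ← map_sub, (QuatAlg.shift_relations (e i)).1,
      AlgHom.commutes, AlgEquiv.commutes] at h₁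
    obtain ⟨x, hx⟩ := mem_of_mem_range_mapMatrix_ofId h₁ ∅ ∅
    rw [Matrix.algebraMap_matrix_apply, if_pos rfl] at hx
    have hx' : (x : F) = a i + e i ^ 2 + e i := hx
    exact hx' ▸ x.2
  refine ⟨L, ?_, fun i => ⟨_, haL i⟩, fun i => ⟨_, hbL i⟩, fun i h0 => hb i (congrArg Subtype.val h0),
    fun i => ⟨(QuatAlg.exists_shift_equiv (e i) rfl).choose⟩, ?_⟩
  · refine (trdeg_adjoin_le k _).trans ((Cardinal.mk_union_le _ _).trans (add_le_add ?_ ?_))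
    · have h := Cardinal.mk_range_le_lift (f := g)
      rw [Cardinal.mk_fintype (Finset (Fin m)), Fintype.card_finset, Fintype.card_fin, Cardinal.lift_natCast,
        Cardinal.lift_uzero, Nat.cast_pow, Nat.cast_two] at h
      exact h
    · simpa using Cardinal.mk_range_le_lift (f := b)
  let a' : Fin m → L := fun i => ⟨_, haL i⟩
  let b' : Fin m → L := fun i => ⟨_, hbL i⟩
  have hσ : ∀ i, ∃ σ : QuatAlg F (algebraMap L F (a' i)) (algebraMap L F (b' i)) ≃ₐ[F]
      QuatAlg F (a i) (b i), σ (QuatAlg.u _ _) = QuatAlg.u (a i) (b i) + algebraMap F _ (e i) ∧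
        σ (QuatAlg.v _ _) = QuatAlg.v (a i) (b i) :=
    fun i => QuatAlg.exists_shift_equiv (e i) rfl
  choose σ hσu hσv using hσ
  choose f hf hfu hfv using fun i => QuatAlg.exists_baseChange (F := F) (a' i) (b' i)
  let j : ∀ i, QuatAlg L (a' i) (b' i) →+* QuatAlg F (a i) (b i) := fun i =>
    ((σ i).toRingEquiv : _ →+* _).comp (f i)
  have hf' : ∀ i t, f i (QuatAlg.gens (a' i) (b' i) t) = QuatAlg.gens _ _ t := by
    intro i t
    match t with
    | 0 => exact map_one (f i)
    | 1 => exact hfu i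
    | 2 => exact hfv i
    | 3 =>
      refine (map_mul (f i) _ _).trans ?_
      rw [hfu, hfv]
      rfl
  have hj : ∀ i t, j i (QuatAlg.gens (a' i) (b' i) t) = σ i (QuatAlg.gens _ _ t) := fun i t =>
    congrArg (σ i) (hf' i t)
  obtain ⟨Θ⟩ := nonempty_algEquiv_matrix_of_descends (L := L)
    (R := fun i => QuatAlg L (a' i) (b' i)) Φ (by simp) j
    (fun i l => (congrArg (σ i) (hf i l)).trans ((σ i).commutes _))
    (fun i => QuatAlg.gens (a' i) (b' i)) (fun i => QuatAlg.span_range_gens) (fun i => by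
      simp only [hj]
      have hs := congrArg (Submodule.map (σ i).toLinearMap) (QuatAlg.span_range_gens
        (a := algebraMap L F (a' i)) (b := algebraMap L F (b' i)))
      rw [Submodule.map_span, ← Set.range_comp, Submodule.map_top,
        LinearMap.range_eq_top.2 (σ i).surjective] at hs
      exact hs) (fun i t => by
      rw [hj]
      match t with
      | 0 =>
        have h1 : σ i (QuatAlg.gens _ _ 0) = 1 := map_one (σ i)
        rw [h1, map_one, map_one]
        exact one_mem S
      | 1 => exact hσu i ▸ hu i
      | 2 => exact hσv i ▸ hv i
      | 3 =>
        have h3 : σ i (QuatAlg.gens _ _ 3) =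
            (QuatAlg.u (a i) (b i) + algebraMap F _ (e i)) * QuatAlg.v (a i) (b i) :=
          (map_mul (σ i) _ _).trans (by rw [hσu, hσv])
        rw [h3, map_mul, map_mul]
        exact mul_mem (hu i) (hv i))
  exact ⟨Θ.trans (Matrix.reindexAlgEquiv L L (Fintype.equivFinOfCardEq (by simp)))⟩
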